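/- arXiv:1807.05624 — 2 statements merged into one kernel-verified Lean document; each statement's English description precedes it below -/
import Mathlib

section
/- Let J be a basic cylinder in M_a and let p be an element of J. Then GS(J,p) = {p + ∑_{i∈Λ(J)} αᵢ·eᵢ ∈ M_a : αᵢ ∈ ℝ for all i ∈ Λ(J)}; equivalently, GS(J,p) consists exactly of those x ∈ M_a with xᵢ = pᵢ for all i ∉ Λ(J). -/
open Filter

noncomputable section

/-- Fix a sequence `a` of positive reals with `∑ aᵢ² < ∞`.  The space
`M_a` consists of the real sequences `x` with `∑ aᵢ² xᵢ² < ∞`. -/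
def Ma (a : ℕ → ℝ) : Set (ℕ → ℝ) := {x | Summable fun i => (a i) ^ 2 * (x i) ^ 2}

/-- The inner product `⟨x,y⟩_a = ∑ aᵢ² xᵢ yᵢ` on `M_a`. -/
def innerA (a : ℕ → ℝ) (x y : ℕ → ℝ) : ℝ := ∑' i, (a i) ^ 2 * (x i * y i)

/-- The metric `d_a(x,y) = (∑ aᵢ² (xᵢ - yᵢ)²)^{1/2}`. -/
def da (a : ℕ → ℝ) (x y : ℕ → ℝ) : ℝ := Real.sqrt (∑' i, (a i) ^ 2 * (x i - y i) ^ 2)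

/-- `eᵢ`: the sequence with `1` in the `i`-th coordinate and `0` elsewhere. -/
def eSeq (i : ℕ) : ℕ → ℝ := Pi.single i 1

/-- `Λ(E) = {i | ∃ x ∈ E, ∃ α ≠ 0, x + α eᵢ ∈ E}`. -/
def Lam (E : Set (ℕ → ℝ)) : Set ℕ :=
  {i | ∃ x ∈ E, ∃ α : ℝ, α ≠ 0 ∧ x + α • eSeq i ∈ E}

/-- Convergence of the series `∑ᵢ f i` to `s` in `M_a`: the partial sums
converge to `s` with respect to the metric `d_a`. -/
def ConvSeries (a : ℕ → ℝ) (f : ℕ → ℕ → ℝ) (s : ℕ → ℝ) : Prop :=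
  Tendsto (fun n => da a (∑ i ∈ Finset.range n, f i) s) atTop (nhds 0)

/-- The generalized linear span `GS(E,p)`: all points `p + ∑ᵢ αᵢ (xᵢ - p) ∈ M_a`
with `xᵢ ∈ E`, `αᵢ ∈ ℝ`, the series converging in `M_a`. -/
def GS (a : ℕ → ℝ) (E : Set (ℕ → ℝ)) (p : ℕ → ℝ) : Set (ℕ → ℝ) :=
  {u | u ∈ Ma a ∧ ∃ x : ℕ → ℕ → ℝ, ∃ α : ℕ → ℝ,
    (∀ i, x i ∈ E) ∧ ConvSeries a (fun i => α i • (x i - p)) (u - p)}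

/-- `E` is a `d_a`-bounded set. -/
def BoundedA (a : ℕ → ℝ) (E : Set (ℕ → ℝ)) : Prop :=
  ∃ C : ℝ, ∀ x ∈ E, ∀ y ∈ E, da a x y ≤ C

/-- `f` is a `d_a`-isometry on `E`. -/
def IsIsomOn (a : ℕ → ℝ) (f : (ℕ → ℝ) → ℕ → ℝ) (E : Set (ℕ → ℝ)) : Prop :=
  ∀ x ∈ E, ∀ y ∈ E, da a (f x) (f y) = da a x y

/-- Data for a basic cylinder: each factor is a nonempty closed subinterval
`[lo i, hi i] ⊆ [0,1]`, and all but finitely many factors equal `[0,1]`. -/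
def IsBCData (lo hi : ℕ → ℝ) : Prop :=
  (∀ i, 0 ≤ lo i) ∧ (∀ i, lo i ≤ hi i) ∧ (∀ i, hi i ≤ 1) ∧
    {i | ¬(lo i = 0 ∧ hi i = 1)}.Finite

/-- The product set `∏ᵢ [lo i, hi i]`. -/
def cylSet (lo hi : ℕ → ℝ) : Set (ℕ → ℝ) := {x | ∀ i, x i ∈ Set.Icc (lo i) (hi i)}

/-- `J` is a basic cylinder. -/
def IsBasicCylinder (J : Set (ℕ → ℝ)) : Prop :=
  ∃ lo hi : ℕ → ℝ, IsBCData lo hi ∧ J = cylSet lo hi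

/-- The elementary volume of a basic cylinder: the product of the lengths of its
edges (a finite product; it is `0` exactly when some factor is a singleton). -/
def bcVol (lo hi : ℕ → ℝ) : ℝ := ∏ᶠ i, (hi i - lo i)

/-- `K` is a cylinder of volume `v`: there are a basic cylinder of elementary
volume `v` and a surjective `d_a`-isometry from it onto `K`. -/
def IsCylVol (a : ℕ → ℝ) (K : Set (ℕ → ℝ)) (v : ℝ) : Prop :=
  ∃ lo hi : ℕ → ℝ, IsBCData lo hi ∧ v = bcVol lo hi ∧
    ∃ f : (ℕ → ℝ) → ℕ → ℝ, IsIsomOn a f (cylSet lo hi) ∧ f '' cylSet lo hi = K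

/-- `K` is a cylinder. -/
def IsCylinder (a : ℕ → ℝ) (K : Set (ℕ → ℝ)) : Prop := ∃ v : ℝ, IsCylVol a K v

/-- The `d_a`-diameter of a set. -/
def daDiam (a : ℕ → ℝ) (K : Set (ℕ → ℝ)) : ℝ := sSup (Set.image2 (da a) K K)

/-- `μ_δ(E)`: the infimum of `∑ vol(Kᵢ)` over countable coverings of `E` by
cylinders of `d_a`-diameter `< δ` (`∞` if no such covering exists). -/
def preMu (a : ℕ → ℝ) (δ : ℝ) (E : Set (ℕ → ℝ)) : ENNReal :=
  sInf {m : ENNReal | ∃ (K : ℕ → Set (ℕ → ℝ)) (v : ℕ → ℝ),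
    (∀ n, IsCylVol a (K n) (v n)) ∧ (∀ n, daDiam a (K n) < δ) ∧
    (E ⊆ ⋃ n, K n) ∧ m = ∑' n, ENNReal.ofReal (v n)}

/-- The outer measure `μ(E) = lim_{δ→0⁺} μ_δ(E) = sup_{δ>0} μ_δ(E)`. -/
def muA (a : ℕ → ℝ) (E : Set (ℕ → ℝ)) : ENNReal :=
  ⨆ (δ : ℝ) (_ : 0 < δ), preMu a δ E

/-- The Hilbert cube `I^ω = [0,1]^ℕ`, viewed as a subset of `M_a`. -/
def cube : Set (ℕ → ℝ) := {x | ∀ i, x i ∈ Set.Icc (0 : ℝ) 1}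

theorem sub_mem_Ma {a x y : ℕ → ℝ} (hx : x ∈ Ma a) (hy : y ∈ Ma a) : x - y ∈ Ma a := by
  refine Summable.of_nonneg_of_le (fun i => by positivity) (fun i => ?_)
    ((Summable.mul_left 2 hx).add (Summable.mul_left 2 hy))
  simp only [Pi.sub_apply]
  nlinarith [mul_nonneg (sq_nonneg (a i)) (sq_nonneg (x i + y i))]

theorem smul_mem_Ma {a x : ℕ → ℝ} (c : ℝ) (hx : x ∈ Ma a) : c • x ∈ Ma a := by
  refine (Summable.mul_left (c ^ 2) hx).congr fun i => ?_
  simp only [Pi.smul_apply, smul_eq_mul]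
  ring

theorem zero_mem_Ma (a : ℕ → ℝ) : (0 : ℕ → ℝ) ∈ Ma a := by
  simp [Ma, summable_zero]

theorem add_mem_Ma {a x y : ℕ → ℝ} (hx : x ∈ Ma a) (hy : y ∈ Ma a) : x + y ∈ Ma a := by
  have h := sub_mem_Ma hx (smul_mem_Ma (-1) hy)
  rwa [neg_one_smul, sub_neg_eq_add] at h

theorem sum_mem_Ma {a : ℕ → ℝ} {f : ℕ → ℕ → ℝ} (hf : ∀ i, f i ∈ Ma a) (n : ℕ) :
    ∑ i ∈ Finset.range n, f i ∈ Ma a := by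
  induction n with
  | zero => simpa using zero_mem_Ma a
  | succ n ih => rw [Finset.sum_range_succ]; exact add_mem_Ma ih (hf n)

theorem cylSet_subset_Ma {a lo hi : ℕ → ℝ} (hsum : Summable fun i => (a i) ^ 2)
    (hJ : IsBCData lo hi) : cylSet lo hi ⊆ Ma a := by
  intro x hx
  refine Summable.of_nonneg_of_le (fun i => by positivity) (fun i => ?_) hsum
  have h0 : 0 ≤ x i := (hJ.1 i).trans (hx i).1
  have h1 : x i ≤ 1 := (hx i).2.trans (hJ.2.2.1 i)
  exact mul_le_of_le_one_right (sq_nonneg _) (pow_le_one₀ h0 h1)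

theorem mul_abs_sub_le_da {a x y : ℕ → ℝ} (hx : x ∈ Ma a) (hy : y ∈ Ma a) (i : ℕ) :
    |a i| * |x i - y i| ≤ da a x y := by
  refine Real.le_sqrt_of_sq_le ?_
  rw [mul_pow, sq_abs, sq_abs]
  exact (sub_mem_Ma hx hy).le_tsum i fun j _ => by positivity

theorem update_mem_cylSet {lo hi p : ℕ → ℝ} (hp : p ∈ cylSet lo hi) {i : ℕ} {t : ℝ}
    (ht : t ∈ Set.Icc (lo i) (hi i)) : Function.update p i t ∈ cylSet lo hi := by
  intro j
  by_cases hj : j = i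
  · subst hj
    simpa using ht
  · simpa [hj] using hp j

theorem update_eq_add_smul_eSeq (p : ℕ → ℝ) (i : ℕ) (t : ℝ) :
    Function.update p i t = p + (t - p i) • eSeq i := by
  ext j
  by_cases hj : j = i
  · subst hj
    simp [eSeq]
  · simp [eSeq, hj]

theorem mem_Lam_of_apply_ne {lo hi p x : ℕ → ℝ} (hp : p ∈ cylSet lo hi) (hx : x ∈ cylSet lo hi)
    {i : ℕ} (h : x i ≠ p i) : i ∈ Lam (cylSet lo hi) := by
  refine ⟨p, hp, x i - p i, sub_ne_zero.2 h, ?_⟩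
  rw [← update_eq_add_smul_eSeq]
  exact update_mem_cylSet hp (hx i)

theorem exists_ne_of_mem_Lam {lo hi : ℕ → ℝ} {i : ℕ} (h : i ∈ Lam (cylSet lo hi)) (c : ℝ) :
    ∃ t ∈ Set.Icc (lo i) (hi i), t ≠ c := by
  obtain ⟨x, hx, α, hα, hxα⟩ := h
  by_cases hc : x i = c
  · refine ⟨_, hxα i, ?_⟩
    simpa [eSeq, hc] using hα
  · exact ⟨_, hx i, hc⟩

/-- Every element of `M_a` is the sum of its coordinate expansion. -/
theorem convSeries_smul_eSeq {a v : ℕ → ℝ} (hv : v ∈ Ma a) :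
    ConvSeries a (fun i => v i • eSeq i) v := by
  have key : ∀ n, da a (∑ i ∈ Finset.range n, v i • eSeq i) v
      = √(∑' k, (a (k + n)) ^ 2 * (v (k + n)) ^ 2) := by
    intro n
    have hval : ∀ j, (∑ i ∈ Finset.range n, v i • eSeq i) j = if j < n then v j else 0 := by
      intro j
      simp [eSeq, Finset.sum_apply, Pi.single_apply]
    have hs : Summable fun j =>
        (a j) ^ 2 * ((∑ i ∈ Finset.range n, v i • eSeq i) j - v j) ^ 2 := by
      refine Summable.of_nonneg_of_le (fun j => by positivity) (fun j => ?_) hv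
      rw [hval]
      split_ifs
      · rw [sub_self, zero_pow two_ne_zero, mul_zero]
        positivity
      · simp
    have hzero : ∑ j ∈ Finset.range n,
        (a j) ^ 2 * ((∑ i ∈ Finset.range n, v i • eSeq i) j - v j) ^ 2 = 0 :=
      Finset.sum_eq_zero fun j hj => by
        rw [hval, if_pos (Finset.mem_range.1 hj)]
        simp
    rw [da, ← hs.sum_add_tsum_nat_add n, hzero, zero_add]
    congr 1
    refine tsum_congr fun k => ?_
    rw [hval, if_neg (by omega)]
    ring
  have htail := (tendsto_sum_nat_add fun i => (a i) ^ 2 * (v i) ^ 2).sqrt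
  rw [Real.sqrt_zero] at htail
  exact htail.congr fun n => (key n).symm

/-- Let `J` be a basic cylinder and `p ∈ J`.  Then `GS(J,p)` consists exactly of
those `x ∈ M_a` with `xᵢ = pᵢ` for all `i ∉ Λ(J)` (equivalently, of all points
`p + ∑_{i ∈ Λ(J)} αᵢ eᵢ ∈ M_a`). -/
theorem ulam_stmt2 (a : ℕ → ℝ) (ha : ∀ i, 0 < a i)
    (hsum : Summable fun i => (a i) ^ 2)
    (lo hi : ℕ → ℝ) (hJ : IsBCData lo hi)
    (p : ℕ → ℝ) (hp : p ∈ cylSet lo hi) :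
    GS a (cylSet lo hi) p
      = {x | x ∈ Ma a ∧ ∀ i, i ∉ Lam (cylSet lo hi) → x i = p i} := by
  have hpM : p ∈ Ma a := cylSet_subset_Ma hsum hJ hp
  ext u
  constructor
  · rintro ⟨hu, x, α, hx, hconv⟩
    refine ⟨hu, fun i hi' => ?_⟩
    have hxi : ∀ k, x k i = p i := fun k => by
      by_contra h
      exact hi' (mem_Lam_of_apply_ne hp (hx k) h)
    have hle : |a i| * |u i - p i| ≤ 0 := by
      refine ge_of_tendsto' hconv fun n => ?_
      have h := mul_abs_sub_le_da (sum_mem_Ma (fun k =>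
        smul_mem_Ma (α k) (sub_mem_Ma (cylSet_subset_Ma hsum hJ (hx k)) hpM)) n)
        (sub_mem_Ma hu hpM) i
      have hz : (∑ k ∈ Finset.range n, α k • (x k - p)) i = 0 := by
        simp [Finset.sum_apply, hxi]
      rwa [hz, zero_sub, abs_neg] at h
    have hpos : 0 < |a i| := abs_pos.2 (ha i).ne'
    exact sub_eq_zero.1 (abs_nonpos_iff.1 (nonpos_of_mul_nonpos_right hle hpos))
  · rintro ⟨hu, hfix⟩
    have hex : ∀ i, ∃ t ∈ Set.Icc (lo i) (hi i), t = p i → u i = p i := by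
      intro i
      by_cases hi' : i ∈ Lam (cylSet lo hi)
      · obtain ⟨t, ht, hne⟩ := exists_ne_of_mem_Lam hi' (p i)
        exact ⟨t, ht, fun h => absurd h hne⟩
      · exact ⟨p i, hp i, fun _ => hfix i hi'⟩
    choose t ht htp using hex
    refine ⟨hu, fun i => Function.update p i (t i), fun i => (u i - p i) / (t i - p i),
      fun i => update_mem_cylSet hp (ht i), ?_⟩
    convert convSeries_smul_eSeq (sub_mem_Ma hu hpM) using 2 with i
    beta_reduce
    rw [update_eq_add_smul_eSeq, add_sub_cancel_left, smul_smul, Pi.sub_apply,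
      div_mul_cancel_of_imp fun h => sub_eq_zero.2 (htp i (sub_eq_zero.1 h))]
end
end

section
/- Let E be a nonempty bounded subset of M_a and p ∈ E. Then the translate GS(E,p) − p is a real linear subspace of M_a: it contains 0 and is closed under addition and scalar multiplication. -/
open Filter

noncomputable section

/-- `M_a` as a linear subspace of the space of all real sequences. -/
def maSubmodule (a : ℕ → ℝ) : Submodule ℝ (ℕ → ℝ) where
  carrier := Ma a
  zero_mem' := by simp [Ma, summable_zero]
  add_mem' {x y} hx hy := by
    refine Summable.of_nonneg_of_le (fun i => by positivity) (fun i => ?_)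
      ((hx.mul_left 2).add (hy.mul_left 2))
    simp only [Pi.add_apply]
    nlinarith [mul_nonneg (sq_nonneg (a i)) (sq_nonneg (x i - y i))]
  smul_mem' c x hx := by
    refine (hx.mul_left (c ^ 2)).congr fun i => ?_
    simp only [Pi.smul_apply, smul_eq_mul]
    ring

theorem da_self (a x : ℕ → ℝ) : da a x x = 0 := by simp [da]

theorem da_nonneg (a x y : ℕ → ℝ) : 0 ≤ da a x y := Real.sqrt_nonneg _

theorem da_sq (a x y : ℕ → ℝ) : da a x y ^ 2 = ∑' i, (a i) ^ 2 * (x i - y i) ^ 2 :=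
  Real.sq_sqrt (tsum_nonneg fun i => by positivity)

theorem da_smul (a : ℕ → ℝ) (c : ℝ) (x y : ℕ → ℝ) :
    da a (c • x) (c • y) = |c| * da a x y := by
  have h : ∀ i, (a i) ^ 2 * ((c • x) i - (c • y) i) ^ 2 =
      c ^ 2 * ((a i) ^ 2 * (x i - y i) ^ 2) := fun i => by
    simp only [Pi.smul_apply, smul_eq_mul]
    ring
  simp only [da, h, tsum_mul_left]
  rw [Real.sqrt_mul (sq_nonneg c), Real.sqrt_sq_eq_abs]

theorem da_add_add_le {a x y u v : ℕ → ℝ} (hx : x ∈ Ma a) (hy : y ∈ Ma a) (hu : u ∈ Ma a)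
    (hv : v ∈ Ma a) : da a (x + y) (u + v) ≤ 2 * (da a x u + da a y v) := by
  have hxu : Summable fun i => (a i) ^ 2 * (x i - u i) ^ 2 := (maSubmodule a).sub_mem hx hu
  have hyv : Summable fun i => (a i) ^ 2 * (y i - v i) ^ 2 := (maSubmodule a).sub_mem hy hv
  have hsum : Summable fun i => (a i) ^ 2 * ((x + y) i - (u + v) i) ^ 2 :=
    (maSubmodule a).sub_mem ((maSubmodule a).add_mem hx hy) ((maSubmodule a).add_mem hu hv)
  have hsq : da a (x + y) (u + v) ^ 2 ≤ 2 * da a x u ^ 2 + 2 * da a y v ^ 2 := by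
    simp only [da_sq]
    rw [← tsum_mul_left, ← tsum_mul_left, ← (hxu.mul_left 2).tsum_add (hyv.mul_left 2)]
    refine hsum.tsum_le_tsum (fun i => ?_) ((hxu.mul_left 2).add (hyv.mul_left 2))
    simp only [Pi.add_apply]
    nlinarith [mul_nonneg (sq_nonneg (a i)) (sq_nonneg ((x i - u i) - (y i - v i)))]
  have h₁ := da_nonneg a x u
  have h₂ := da_nonneg a y v
  refine le_of_sq_le_sq ?_ (by positivity)
  nlinarith [mul_nonneg h₁ h₂]

theorem ConvSeries.const_smul {a : ℕ → ℝ} {f : ℕ → ℕ → ℝ} {s : ℕ → ℝ} (c : ℝ)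
    (hf : ConvSeries a f s) : ConvSeries a (fun i => c • f i) (c • s) := by
  simp only [ConvSeries, ← Finset.smul_sum, da_smul]
  simpa using Tendsto.const_mul |c| hf

/-- The sequence `f 0, g 0, f 1, g 1, …`. -/
def interleave {β : Type*} (f g : ℕ → β) (n : ℕ) : β :=
  if n % 2 = 0 then f (n / 2) else g (n / 2)

theorem sum_range_interleave {β : Type*} [AddCommMonoid β] (f g : ℕ → β) (n : ℕ) :
    ∑ i ∈ Finset.range n, interleave f g i =
      ∑ i ∈ Finset.range ((n + 1) / 2), f i + ∑ i ∈ Finset.range (n / 2), g i := by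
  induction n with
  | zero => simp
  | succ n ih =>
    rw [Finset.sum_range_succ, ih, interleave]
    split_ifs with h
    · rw [show (n + 1 + 1) / 2 = n / 2 + 1 by lia, show (n + 1) / 2 = n / 2 by lia,
        Finset.sum_range_succ f, add_right_comm]
    · rw [show (n + 1 + 1) / 2 = (n + 1) / 2 by lia, show (n + 1) / 2 = n / 2 + 1 by lia,
        Finset.sum_range_succ g, add_assoc]

theorem ConvSeries.interleave {a : ℕ → ℝ} {f g : ℕ → ℕ → ℝ} {s t : ℕ → ℝ}
    (hf : ConvSeries a f s) (hg : ConvSeries a g t) (hfM : ∀ i, f i ∈ Ma a)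
    (hgM : ∀ i, g i ∈ Ma a) (hs : s ∈ Ma a) (ht : t ∈ Ma a) :
    ConvSeries a (interleave f g) (s + t) := by
  have hdiv : Tendsto (fun n : ℕ => n / 2) atTop atTop := Nat.tendsto_div_const_atTop two_ne_zero
  have hlim := ((hf.comp (hdiv.comp (tendsto_add_atTop_nat 1))).add (hg.comp hdiv)).const_mul 2
  rw [add_zero, mul_zero] at hlim
  refine squeeze_zero (fun n => da_nonneg _ _ _) (fun n => ?_) hlim
  rw [sum_range_interleave]
  exact da_add_add_le ((maSubmodule a).sum_mem fun i _ => hfM i)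
    ((maSubmodule a).sum_mem fun i _ => hgM i) hs ht

theorem mem_image_sub_GS {a : ℕ → ℝ} {E : Set (ℕ → ℝ)} {p : ℕ → ℝ} (hp : p ∈ Ma a)
    {w : ℕ → ℝ} : w ∈ (fun x => x - p) '' GS a E p ↔
      w ∈ Ma a ∧ ∃ x : ℕ → ℕ → ℝ, ∃ α : ℕ → ℝ,
        (∀ i, x i ∈ E) ∧ ConvSeries a (fun i => α i • (x i - p)) w := by
  constructor
  · rintro ⟨u, ⟨hu, h⟩, rfl⟩
    exact ⟨(maSubmodule a).sub_mem hu hp, h⟩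
  · rintro ⟨hw, h⟩
    refine ⟨w + p, ⟨(maSubmodule a).add_mem hw hp, ?_⟩, add_sub_cancel_right w p⟩
    rwa [add_sub_cancel_right]

/-- `GS(E,p) - p` is a real linear subspace of `M_a`: it contains `0` and is
closed under addition and scalar multiplication. -/
theorem ulam_stmt7 (a : ℕ → ℝ) (ha : ∀ i, 0 < a i)
    (hsum : Summable fun i => (a i) ^ 2)
    (E : Set (ℕ → ℝ)) (hne : E.Nonempty) (hEM : E ⊆ Ma a) (hEb : BoundedA a E)
    (p : ℕ → ℝ) (hp : p ∈ E) :
    (0 : ℕ → ℝ) ∈ (fun x => x - p) '' GS a E p ∧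
    (∀ x ∈ (fun x => x - p) '' GS a E p, ∀ y ∈ (fun x => x - p) '' GS a E p,
      x + y ∈ (fun x => x - p) '' GS a E p) ∧
    (∀ (c : ℝ), ∀ x ∈ (fun x => x - p) '' GS a E p,
      c • x ∈ (fun x => x - p) '' GS a E p) := by
  have hpM := hEM hp
  simp only [mem_image_sub_GS hpM]
  refine ⟨⟨(maSubmodule a).zero_mem, fun _ => p, 0, fun _ => hp, ?_⟩, ?_, ?_⟩
  · simp [ConvSeries, da_self]
  · rintro w ⟨hw, x, α, hx, hxw⟩ z ⟨hz, y, β, hy, hyz⟩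
    have hM {x : ℕ → ℕ → ℝ} (α : ℕ → ℝ) (hx : ∀ i, x i ∈ E) (i : ℕ) :
        α i • (x i - p) ∈ Ma a :=
      (maSubmodule a).smul_mem _ ((maSubmodule a).sub_mem (hEM (hx i)) hpM)
    refine ⟨(maSubmodule a).add_mem hw hz, interleave x y, interleave α β, fun i => ?_, ?_⟩
    · unfold interleave
      split_ifs
      exacts [hx _, hy _]
    · convert hxw.interleave hyz (hM α hx) (hM β hy) hw hz using 2 with i
      unfold interleave
      split_ifs <;> rfl
  · rintro c w ⟨hw, x, α, hx, hxw⟩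
    refine ⟨(maSubmodule a).smul_mem c hw, x, c • α, hx, ?_⟩
    simpa [smul_smul] using hxw.const_smul c
end
end
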